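/- Let (fᵢ) be a sequence of expanding maps generating full shifts with bounded distortion, (mᵢ) natural numbers, and (p̄ᵢ) probability vectors on words of length mᵢ. Then dim_H(⋂ᵢ {x : p̄ᵢ ∈ A^{fᵢ,mᵢ}(x)}) = infᵢ dim_H({x : p̄ᵢ ∈ A^{fᵢ,mᵢ}(x)}): the Hausdorff dimension of the countable intersection of accumulation-frequency sets equals the infimum of their dimensions. -/

import Mathlib

open Set MeasureTheory Filter
open scoped ENNReal Classical

noncomputable section

/-- A similarity transformation of `ℝ`. -/
def IsSimilarity (f : ℝ → ℝ) : Prop := ∃ a b : ℝ, a ≠ 0 ∧ ∀ x, f x = a * x + b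

/-- Falconer's class `𝒢^s`: Gδ sets all of whose images under countably many
similarities intersect in a set of Hausdorff dimension at least `s`. -/
def falconerClass (s : ℝ) : Set (Set ℝ) :=
  {F | IsGδ F ∧ ∀ T : ℕ → ℝ → ℝ, (∀ i, IsSimilarity (T i)) →
    ENNReal.ofReal s ≤ dimH (⋂ i, T i '' F)}

/-- A probability vector indexed by a finite type. -/
def IsProbVector {ι : Type*} [Fintype ι] (p : ι → ℝ) : Prop :=
  (∀ i, 0 ≤ p i) ∧ ∑ i, p i = 1

/-- A dyadic half-open interval `[2^k m, 2^k (m+1))`. -/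
def IsDyadic (I : Set ℝ) : Prop :=
  ∃ (k m : ℤ), I = Ico ((2:ℝ) ^ k * m) ((2:ℝ) ^ k * (m + 1))

/-- The outer measure `M^s_∞` obtained from countable covers by dyadic intervals. -/
def dyadicMeasure (s : ℝ) (A : Set ℝ) : ℝ≥0∞ :=
  ⨅ (I : ℕ → Set ℝ) (_ : ∀ i, IsDyadic (I i)) (_ : A ⊆ ⋃ i, I i),
    ∑' i, volume (I i) ^ s

/-- Extension of a subset of `[0,1)` to `ℝ` by integer translations. -/
def periodize (A : Set ℝ) : Set ℝ := ⋃ k : ℤ, (fun x => x + (k : ℝ)) '' A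

/-- An expanding interval map on `[0,1)` with `g` full monotone branches,
generating a full shift on `g` symbols. -/
structure ExpandingFullShift where
  g : ℕ
  one_lt_g : 1 < g
  branch : Fin g → Set ℝ
  branch_Ico : ∀ i, ∃ a b : ℝ, a < b ∧ branch i = Ico a b
  branch_cover : (⋃ i, branch i) = Ico (0:ℝ) 1
  branch_disjoint : ∀ i j, i ≠ j → Disjoint (branch i) (branch j)
  f : ℝ → ℝ
  f_onto : ∀ i, f '' branch i = Ico (0:ℝ) 1
  f_mono : ∀ i, StrictMonoOn f (branch i) ∨ StrictAntiOn f (branch i)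
  f_expanding : ∀ i, ∀ x ∈ branch i, ∀ y ∈ branch i, |x - y| ≤ |f x - f y|

namespace ExpandingFullShift

variable (E : ExpandingFullShift)

/-- The symbol `0`. -/
def zeroSym : Fin E.g := ⟨0, Nat.lt_trans Nat.one_pos E.one_lt_g⟩

/-- The cylinder `C_{x₁ … x_n} ⊆ [0,1)` determined by a word `w`. -/
def cylinder (w : List (Fin E.g)) : Set ℝ :=
  {x ∈ Ico (0:ℝ) 1 | ∀ k (hk : k < w.length), E.f^[k] x ∈ E.branch (w.get ⟨k, hk⟩)}

/-- A cylinder in some interval `[k, k+1)`, `k ∈ ℤ` (periodic extension of the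
cylinder structure to `ℝ`). -/
def IsCylinderZ (C : Set ℝ) : Prop :=
  ∃ (w : List (Fin E.g)) (k : ℤ), C = (fun x => x + (k : ℝ)) '' E.cylinder w

/-- The outer measure `N^s_∞` obtained from countable covers by cylinders of `E`. -/
def cylMeasure (s : ℝ) (A : Set ℝ) : ℝ≥0∞ :=
  ⨅ (c : ℕ → List (Fin E.g)) (_ : A ⊆ ⋃ i, E.cylinder (c i)),
    ∑' i, volume (E.cylinder (c i)) ^ s

/-- The outer measure `N^s_∞` from covers by cylinders of the periodic extension. -/
def cylMeasureZ (s : ℝ) (A : Set ℝ) : ℝ≥0∞ :=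
  ⨅ (c : ℕ → Set ℝ) (_ : ∀ i, E.IsCylinderZ (c i)) (_ : A ⊆ ⋃ i, c i),
    ∑' i, volume (c i) ^ s

/-- The empirical frequency `τ^f_w(x,n)/(n-m)` of the word `w` (of length `m`)
in the first `n` symbols of the expansion of `x`. -/
def freq {m : ℕ} (w : Fin m → Fin E.g) (x : ℝ) (n : ℕ) : ℝ :=
  (((Finset.range (n - m)).filter
      (fun i => ∀ k : Fin m, E.f^[i + k] x ∈ E.branch (w k))).card : ℝ) / ((n - m : ℕ) : ℝ)

/-- `G^{f,m}_{p̄}`: the set of points whose length-`m` word frequencies converge to `p̄`. -/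
def Gset (m : ℕ) (p : (Fin m → Fin E.g) → ℝ) : Set ℝ :=
  {x ∈ Ico (0:ℝ) 1 | ∀ w : Fin m → Fin E.g,
    Tendsto (fun n => E.freq w x n) atTop (nhds (p w))}

/-- `G^{f,m}_{p̄}(n,ε)`: points whose empirical length-`m` word frequencies at time `n`
are within `ε` of `p̄` componentwise. -/
def GsetApprox (m : ℕ) (p : (Fin m → Fin E.g) → ℝ) (n : ℕ) (ε : ℝ) : Set ℝ :=
  {x ∈ Ico (0:ℝ) 1 | ∀ w : Fin m → Fin E.g, |E.freq w x n - p w| < ε}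

/-- `p̄ ∈ A^{f,m}(x)`: the vector `p̄` is an accumulation point of the empirical
frequency vectors of `x` as `n → ∞`. -/
def IsFreqAccum (m : ℕ) (p : (Fin m → Fin E.g) → ℝ) (x : ℝ) : Prop :=
  MapClusterPt p atTop (fun n => fun w => E.freq w x n)

/-- `x` is `m`-normal to `f`: every length-`m` word occurs with frequency equal to
the length of the corresponding cylinder. -/
def IsNormal (m : ℕ) (x : ℝ) : Prop :=
  ∀ w : Fin m → Fin E.g,
    Tendsto (fun n => E.freq w x n) atTop (nhds (volume (E.cylinder (List.ofFn w))).toReal)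

/-- Bounded distortion with constant `K`:
`|C_u||C_v|/K ≤ |C_{uv}| ≤ K |C_u||C_v|` for all words `u, v`. -/
def HasBoundedDistortion (K : ℝ) : Prop :=
  ∀ u v : List (Fin E.g),
    volume (E.cylinder (u ++ v)) ≤
      ENNReal.ofReal K * (volume (E.cylinder u) * volume (E.cylinder v)) ∧
    volume (E.cylinder u) * volume (E.cylinder v) ≤
      ENNReal.ofReal K * volume (E.cylinder (u ++ v))

/-- Condition (ii): for each `m` there is `p̄` with `dim_H G^{f,m}_{p̄} = 1`, and for
each word `w` of length `m` there are vectors `q̄` with `q_w ≠ p_w` whose `G`-set has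
Hausdorff dimension arbitrarily close to `1`. -/
def CondII : Prop :=
  ∀ m : ℕ, 0 < m → ∃ p : (Fin m → Fin E.g) → ℝ, IsProbVector p ∧ dimH (E.Gset m p) = 1 ∧
    ∀ w : Fin m → Fin E.g, ∀ t : ℝ≥0∞, t < 1 → ∃ q : (Fin m → Fin E.g) → ℝ,
      IsProbVector q ∧ q w ≠ p w ∧ t ≤ dimH (E.Gset m q)

end ExpandingFullShift

/-- `V` is `t`-spreadable if `[0,1)` admits arbitrarily fine finite partitions into half-open
intervals, each carrying a probability measure of bounded density which is supported on `V` and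
satisfies a Frostman condition of exponent `t`, with a constant that is uniform over the
partitions. -/
def IsSpreadable (t : ℝ) (V : Set ℝ) : Prop :=
  ∃ C : ℝ≥0∞, C ≠ ⊤ ∧ ∀ δ : ℝ, 0 < δ →
    ∃ (ι : Type) (_ : Fintype ι) (a b : ι → ℝ) (ν : ι → Measure ℝ),
      (∀ i, a i < b i ∧ b i - a i ≤ δ) ∧
      Pairwise (Function.onFun Disjoint fun i => Ico (a i) (b i)) ∧
      Ico 0 1 ⊆ ⋃ i, Ico (a i) (b i) ∧
      ∀ i, ν i univ = 1 ∧ ν i (Ico (a i) (b i) ∩ V)ᶜ = 0 ∧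
        (∃ D : ℝ≥0∞, D ≠ ⊤ ∧ ∀ s, ν i s ≤ D * volume s) ∧
        ∀ x y, ν i (Ico x y) * volume (Ico (a i) (b i)) ^ t ≤ C * volume (Ico x y) ^ t

/-- A stage of the construction of a Cantor set: an open subset of `[0,1)` carrying a measure of
bounded density, with a uniform Frostman condition of exponent `t` and a uniform lower bound on
the mass. -/
structure IsCantorStage (t : ℝ) (O : Set ℝ) (μ : Measure ℝ) : Prop where
  isOpen : IsOpen O
  subset : O ⊆ Ico 0 1
  measure_compl : μ Oᶜ = 0
  lt_mass : 1 / 2 < μ univ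
  density : ∃ D : ℝ≥0∞, D ≠ ⊤ ∧ ∀ s, μ s ≤ D * volume s
  frostman : ∃ M : ℝ≥0∞, M < 2 ∧ ∀ x y, μ (Ico x y) ≤ M * volume (Ico x y) ^ t

theorem sum_ite_mem_le_of_pairwise_disjoint {α ι : Type*} [Fintype ι] {I : ι → Set α}
    [∀ x i, Decidable (x ∈ I i)]
    (hI : Pairwise (Function.onFun Disjoint I)) (x : α) (e : ℝ≥0∞) :
    ∑ i, (if x ∈ I i then e else 0) ≤ e := by
  by_cases h : ∃ i, x ∈ I i
  · obtain ⟨i, hi⟩ := h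
    rw [Finset.sum_eq_single i]
    · simp [hi]
    · intro j _ hj
      rw [if_neg]
      exact fun hxj => Set.disjoint_left.1 (hI hj) hxj hi
    · simp
  · push Not at h
    simp [h]

namespace IsCantorStage

variable {t : ℝ} {O V : Set ℝ} {μ : Measure ℝ}

theorem isFiniteMeasure (h : IsCantorStage t O μ) : IsFiniteMeasure μ := by
  obtain ⟨D, hD, hle⟩ := h.density
  refine ⟨?_⟩
  calc μ univ ≤ μ O + μ Oᶜ := by rw [← union_compl_self O]; exact measure_union_le _ _
    _ = μ O := by rw [h.measure_compl, add_zero]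
    _ ≤ D * volume O := hle O
    _ ≤ D * volume (Ico (0:ℝ) 1) := by gcongr; exact h.subset
    _ < ⊤ := by simpa using hD.lt_top

theorem measure_eq_univ (h : IsCantorStage t O μ) : μ O = μ univ :=
  measure_eq_measure_of_null_sdiff (subset_univ _) (by rw [← compl_eq_univ_sdiff, h.measure_compl])

theorem restrict_Ioo (ht0 : 0 < t) (ht1 : t < 1) :
    IsCantorStage t (Ioo 0 1) (volume.restrict (Ioo 0 1)) where
  isOpen := isOpen_Ioo
  subset := Ioo_subset_Ico_self
  measure_compl := by simp [Measure.restrict_apply]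
  lt_mass := by simp
  density := ⟨1, by simp, fun s => by
    rw [one_mul]; exact Measure.restrict_apply_le _ s⟩
  frostman := by
    refine ⟨1, by norm_num, fun x y => ?_⟩
    rw [one_mul]
    rcases le_total (volume (Ico x y)) 1 with h | h
    · calc _ ≤ volume (Ico x y) := Measure.restrict_apply_le _ _
        _ = volume (Ico x y) ^ (1:ℝ) := by simp
        _ ≤ _ := ENNReal.rpow_le_rpow_of_exponent_ge h ht1.le
    · calc _ ≤ volume.restrict (Ioo (0:ℝ) 1) univ := measure_mono (subset_univ _)
        _ = 1 := by simp
        _ ≤ _ := ENNReal.one_le_rpow h ht0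

/-- Inside a stage, spreading the mass of a fine enough partition over `V` costs
arbitrarily little in the Frostman constant. -/
theorem exists_redistribution (h : IsCantorStage t O μ) (ht1 : t < 1)
    (hV : IsSpreadable t V) :
    ∃ μ' : Measure ℝ, μ' (O ∩ V)ᶜ = 0 ∧ 1 / 2 < μ' univ ∧
      (∃ D : ℝ≥0∞, D ≠ ⊤ ∧ ∀ s, μ' s ≤ D * volume s) ∧
      ∃ M : ℝ≥0∞, M < 2 ∧ ∀ x y, μ' (Ico x y) ≤ M * volume (Ico x y) ^ t := by
  have := h.isFiniteMeasure
  obtain ⟨D, hD, hDle⟩ := h.density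
  obtain ⟨M, hM, hMle⟩ := h.frostman
  obtain ⟨C, hC, hspread⟩ := hV
  obtain ⟨η, hη, hMη⟩ := ENNReal.lt_iff_exists_add_pos_lt.1 hM
  obtain ⟨K, hKO, hK, hμK⟩ := h.isOpen.exists_lt_isCompact (h.measure_eq_univ ▸ h.lt_mass)
  obtain ⟨δ₀, hδ₀, hthick⟩ := hK.exists_thickening_subset_open h.isOpen hKO
  have hlim : Tendsto (fun δ : ℝ => 2 * (D * C) * ENNReal.ofReal δ ^ (1 - t)) (nhds 0) (nhds 0) := by
    have h1 : Tendsto (fun δ : ℝ => ENNReal.ofReal δ ^ (1 - t)) (nhds 0) (nhds 0) := by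
      have : Continuous fun δ : ℝ => ENNReal.ofReal δ ^ (1 - t) :=
        ENNReal.continuous_rpow_const.comp ENNReal.continuous_ofReal
      simpa [ENNReal.zero_rpow_of_pos (sub_pos.2 ht1)] using this.tendsto 0
    simpa using ENNReal.Tendsto.const_mul h1
      (Or.inr (ENNReal.mul_ne_top (by simp) (ENNReal.mul_ne_top hD hC)))
  obtain ⟨δ, ⟨hδη, hδδ₀⟩, hδ⟩ : ∃ δ : ℝ,
      (2 * (D * C) * ENNReal.ofReal δ ^ (1 - t) < η ∧ δ < δ₀) ∧ 0 < δ := by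
    have h1 := hlim.eventually (gt_mem_nhds (show (0:ℝ≥0∞) < η by exact_mod_cast hη))
    have h2 : ∀ᶠ δ : ℝ in nhds 0, δ < δ₀ := gt_mem_nhds hδ₀
    exact (((h1.and h2).filter_mono (nhdsWithin_le_nhds (s := Ioi 0))).and
      self_mem_nhdsWithin).exists
  obtain ⟨ι, _, a, b, ν, hab, hdisj, hcov, hν⟩ := hspread δ hδ
  choose hν1 hν2 hν3 hν4 using hν
  choose D' hD' hD'le using hν3
  set I : ι → Set ℝ := fun i => Ico (a i) (b i) with hI
  set S : Finset ι := Finset.univ.filter fun i => I i ⊆ O with hS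
  have happly : ∀ s, (∑ i ∈ S, μ (I i) • ν i) s = ∑ i ∈ S, μ (I i) * ν i s := by
    intro s; simp [Measure.finsetSum_apply]
  refine ⟨∑ i ∈ S, μ (I i) • ν i, ?_, ?_, ⟨∑ i ∈ S, μ (I i) * D' i, ?_, ?_⟩, M + η, hMη, ?_⟩
  · rw [happly]
    refine Finset.sum_eq_zero fun i hi => ?_
    have hiO : I i ⊆ O := by simpa [hS] using hi
    have : ν i (O ∩ V)ᶜ = 0 := measure_mono_null
      (compl_subset_compl.2 (inter_subset_inter_left V hiO)) (hν2 i)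
    rw [this, mul_zero]
  · rw [happly]
    refine hμK.trans_le ?_
    calc μ K ≤ μ (⋃ i ∈ S, I i) := by
          refine measure_mono fun x hx => ?_
          obtain ⟨i, hi⟩ := mem_iUnion.1 (hcov (h.subset (hKO hx)))
          refine mem_biUnion (x := i) ?_ hi
          simp only [hS, Finset.coe_filter, Finset.mem_univ, true_and, mem_ofPred_eq]
          refine fun y hy => hthick (Metric.mem_thickening_iff.2 ⟨x, hx, ?_⟩)
          have := (hab i).2
          rw [Real.dist_eq, abs_lt]
          constructor <;> linarith [hi.1, hi.2, hy.1, hy.2]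
      _ ≤ ∑ i ∈ S, μ (I i) := measure_biUnion_finset_le _ _
      _ = ∑ i ∈ S, μ (I i) * ν i univ := by simp [hν1]
  · exact (ENNReal.sum_lt_top.2 fun i _ =>
      ENNReal.mul_lt_top (measure_lt_top _ _) (hD' i).lt_top).ne
  · intro s
    rw [happly, Finset.sum_mul]
    refine Finset.sum_le_sum fun i _ => ?_
    rw [mul_assoc]
    exact mul_le_mul_right (hD'le i s) _
  · intro x y
    rw [happly]
    set e : ℝ≥0∞ := D * C * ENNReal.ofReal δ ^ (1 - t) * volume (Ico x y) ^ t with he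
    have hterm : ∀ i, μ (I i) * ν i (Ico x y) ≤ (if I i ⊆ Ico x y then μ (I i) else 0) +
        ((if x ∈ I i then e else 0) + (if y ∈ I i then e else 0)) := by
      intro i
      by_cases hsub : I i ⊆ Ico x y
      · rw [if_pos hsub]
        refine le_add_right ?_
        calc μ (I i) * ν i (Ico x y) ≤ μ (I i) * ν i univ := by gcongr; exact subset_univ _
          _ = μ (I i) := by rw [hν1, mul_one]
      by_cases hd : Disjoint (I i) (Ico x y)
      · have : ν i (Ico x y) = 0 := by
          refine measure_mono_null ?_ (hν2 i)
          exact fun z hz hz' => Set.disjoint_left.1 hd hz'.1 hz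
        simp [this]
      have hbound : μ (I i) * ν i (Ico x y) ≤ e := by
        have hIpos : volume (I i) ≠ 0 := by simp [hI, (hab i).1]
        have hItop : volume (I i) ≠ ⊤ := by simp [hI]
        calc μ (I i) * ν i (Ico x y) ≤ D * volume (I i) * ν i (Ico x y) := by
              gcongr; exact hDle _
          _ = D * volume (I i) ^ (1 - t) * (ν i (Ico x y) * volume (I i) ^ t) := by
              have : volume (I i) = volume (I i) ^ (1 - t) * volume (I i) ^ t := by
                rw [← ENNReal.rpow_add _ _ hIpos hItop]; simp
              conv_lhs => rw [this]
              ring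
          _ ≤ D * ENNReal.ofReal δ ^ (1 - t) * (C * volume (Ico x y) ^ t) := by
              have hvol : volume (I i) ≤ ENNReal.ofReal δ := by
                rw [hI, Real.volume_Ico]
                exact ENNReal.ofReal_le_ofReal (hab i).2
              exact mul_le_mul' (by gcongr) (hν4 i x y)
          _ = e := by rw [he]; ring
      have : x ∈ I i ∨ y ∈ I i := by
        obtain ⟨z, hz1, hz2⟩ := Set.not_disjoint_iff.1 hd
        obtain ⟨u, hu1, hu2⟩ := Set.not_subset.1 hsub
        simp only [hI, mem_Ico, not_and, not_lt] at *
        by_cases hux : x ≤ u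
        · right; constructor <;> linarith [hu2 hux]
        · left; constructor <;> linarith
      rcases this with hx | hy
      · rw [if_pos hx]
        exact hbound.trans (le_add_left (le_add_right le_rfl))
      · rw [if_pos hy]
        exact hbound.trans (le_add_left (le_add_left le_rfl))
    calc ∑ i ∈ S, μ (I i) * ν i (Ico x y) ≤ ∑ i, μ (I i) * ν i (Ico x y) :=
          Finset.sum_le_sum_of_subset (Finset.subset_univ _)
      _ ≤ ∑ i, ((if I i ⊆ Ico x y then μ (I i) else 0) +
        ((if x ∈ I i then e else 0) + (if y ∈ I i then e else 0))) :=
          Finset.sum_le_sum fun i _ => hterm i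
      _ ≤ M * volume (Ico x y) ^ t + (e + e) := by
          rw [Finset.sum_add_distrib, Finset.sum_add_distrib]
          refine add_le_add ?_ (add_le_add (sum_ite_mem_le_of_pairwise_disjoint hdisj x e)
            (sum_ite_mem_le_of_pairwise_disjoint hdisj y e))
          rw [← Finset.sum_filter, ← measure_biUnion_finset (fun i _ j _ hij => hdisj hij)
            (fun i _ => measurableSet_Ico)]
          refine le_trans (measure_mono ?_) (hMle x y)
          simp
      _ = (M + 2 * (D * C) * ENNReal.ofReal δ ^ (1 - t)) * volume (Ico x y) ^ t := by
          rw [he]; ring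
      _ ≤ (M + η) * volume (Ico x y) ^ t := by gcongr

theorem exists_succ (h : IsCantorStage t O μ) (ht1 : t < 1)
    (hVo : IsOpen V) (hV : IsSpreadable t V) :
    ∃ (O' : Set ℝ) (μ' : Measure ℝ), IsCantorStage t O' μ' ∧ closure O' ⊆ O ∩ V ∧
      IsCompact (closure O') := by
  obtain ⟨μ', hnull, hmass, ⟨D, hD, hDle⟩, M, hM, hMle⟩ := h.exists_redistribution ht1 hV
  have hUo : IsOpen (O ∩ V) := h.isOpen.inter hVo
  have hU : μ' (O ∩ V) = μ' univ :=
    measure_eq_measure_of_null_sdiff (subset_univ _) (by rw [← compl_eq_univ_sdiff, hnull])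
  have : IsFiniteMeasure μ' := by
    refine ⟨?_⟩
    calc μ' univ = μ' (O ∩ V) := hU.symm
      _ ≤ D * volume (O ∩ V) := hDle _
      _ ≤ D * volume (Ico (0:ℝ) 1) := by gcongr; exact inter_subset_left.trans h.subset
      _ < ⊤ := by simpa using hD.lt_top
  obtain ⟨K, hKU, hK, hμK⟩ := hUo.exists_lt_isCompact (hU ▸ hmass)
  obtain ⟨O', hO', hKO', hcl, hcomp⟩ := exists_open_between_and_isCompact_closure hK hUo hKU
  refine ⟨O', μ'.restrict O', ⟨hO', ?_, ?_, ?_, ⟨D, hD, fun s => ?_⟩, M, hM, fun x y => ?_⟩,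
    hcl, hcomp⟩
  · exact (subset_closure.trans hcl).trans (inter_subset_left.trans h.subset)
  · simp [Measure.restrict_apply hO'.measurableSet.compl]
  · simpa using hμK.trans_le (measure_mono hKO')
  · exact (Measure.restrict_apply_le _ s).trans (hDle s)
  · exact (Measure.restrict_apply_le _ _).trans (hMle x y)

end IsCantorStage

/-- A cover of a nested intersection of closures of Cantor stages cannot have small
`t`-dimensional size. -/
theorem IsCantorStage.half_le_of_cover {t : ℝ} (ht0 : 0 < t) (ht1 : t < 1) {O : ℕ → Set ℝ}
    {μ : ℕ → Measure ℝ} (hst : ∀ n, IsCantorStage t (O n) (μ n))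
    (hanti : Antitone fun n => closure (O n)) (hcomp : ∀ n, IsCompact (closure (O n)))
    {s : ℕ → Set ℝ} (hs : (⋂ n, closure (O n)) ⊆ ⋃ n, s n) {ε : ℝ≥0∞} (hε : ε ≠ 0) :
    1 / 2 ≤ 4 * ((∑' n, ⨆ _ : (s n).Nonempty, Metric.ediam (s n) ^ t) + ε) := by
  set q : ℕ → ℝ≥0∞ := fun n => ⨆ _ : (s n).Nonempty, Metric.ediam (s n) ^ t with hq
  by_cases htop : ∑' n, q n = ⊤
  · simp [htop]
  obtain ⟨e, he0, hesum⟩ := ENNReal.exists_pos_sum_of_countable' hε ℕ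
  set R : ℕ → ℝ≥0∞ := fun n => (q n + e n) ^ (1 / t) with hR
  have hqtop : ∀ n, q n ≠ ⊤ := ENNReal.ne_top_of_tsum_ne_top htop
  have hetop : ∀ n, e n ≠ ⊤ := ENNReal.ne_top_of_tsum_ne_top (hesum.trans_le le_top).ne
  have hRtop : ∀ n, R n ≠ ⊤ := fun n =>
    ENNReal.rpow_ne_top_of_nonneg (by positivity) (ENNReal.add_ne_top.2 ⟨hqtop n, hetop n⟩)
  have hRt : ∀ n, R n ^ t = q n + e n := fun n => by
    rw [hR, ← ENNReal.rpow_mul, one_div_mul_cancel ht0.ne', ENNReal.rpow_one]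
  have hball : ∀ n, ∃ x : ℝ, s n ⊆ Metric.eball x (R n) := by
    intro n
    rcases (s n).eq_empty_or_nonempty with h | h
    · exact ⟨0, by simp [h]⟩
    · obtain ⟨x, hx⟩ := h
      refine ⟨x, fun y hy => ?_⟩
      have hlt : Metric.ediam (s n) < R n := by
        rw [← ENNReal.rpow_lt_rpow_iff ht0, hRt]
        have : q n = Metric.ediam (s n) ^ t := by simp only [hq]; exact iSup_pos ⟨x, hx⟩
        rw [← this]
        exact ENNReal.lt_add_right (hqtop n) (he0 n).ne'
      exact (Metric.edist_le_ediam_of_mem hy hx).trans_lt hlt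
  choose x hx using hball
  obtain ⟨j, hj⟩ : ∃ j, closure (O j) ⊆ ⋃ n, Metric.eball (x n) (R n) := by
    refine exists_subset_nhds_of_isCompact hanti.directed_ge hcomp fun y hy => ?_
    exact (isOpen_iUnion fun n => Metric.isOpen_eball).mem_nhds
      (iUnion_mono hx (hs hy))
  obtain ⟨M, hM, hMle⟩ := (hst j).frostman
  have hterm : ∀ n, μ j (Metric.eball (x n) (R n)) ≤ 4 * (q n + e n) := by
    intro n
    have hball : Metric.eball (x n) (R n) ⊆ Ico (x n - (R n).toReal) (x n + (R n).toReal) := by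
      rw [← ENNReal.ofReal_toReal (hRtop n), Metric.eball_ofReal, Real.ball_eq_Ioo]
      simpa [ENNReal.toReal_ofReal] using Ioo_subset_Ico_self
    have h2 : (2:ℝ≥0∞) ^ t ≤ 2 := by
      conv_rhs => rw [← ENNReal.rpow_one 2]
      exact ENNReal.rpow_le_rpow_of_exponent_le (by norm_num) ht1.le
    calc μ j (Metric.eball (x n) (R n))
        ≤ M * volume (Ico (x n - (R n).toReal) (x n + (R n).toReal)) ^ t :=
          (measure_mono hball).trans (hMle _ _)
      _ = M * (2 * R n) ^ t := by
          rw [Real.volume_Ico]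
          congr 2
          rw [show x n + (R n).toReal - (x n - (R n).toReal) = 2 * (R n).toReal by ring,
            ENNReal.ofReal_mul (by norm_num), ENNReal.ofReal_toReal (hRtop n)]
          simp
      _ = M * 2 ^ t * (q n + e n) := by
          rw [ENNReal.mul_rpow_of_nonneg _ _ ht0.le, hRt, mul_assoc]
      _ ≤ 2 * 2 * (q n + e n) := by gcongr
      _ = 4 * (q n + e n) := by norm_num
  calc 1 / 2 ≤ μ j univ := (hst j).lt_mass.le
    _ = μ j (O j) := (hst j).measure_eq_univ.symm
    _ ≤ μ j (⋃ n, Metric.eball (x n) (R n)) := measure_mono (subset_closure.trans hj)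
    _ ≤ ∑' n, μ j (Metric.eball (x n) (R n)) := measure_iUnion_le _
    _ ≤ ∑' n, 4 * (q n + e n) := ENNReal.tsum_le_tsum hterm
    _ = 4 * ((∑' n, q n) + ∑' n, e n) := by rw [ENNReal.tsum_mul_left, ENNReal.tsum_add]
    _ ≤ 4 * ((∑' n, q n) + ε) := by gcongr

theorem le_dimH_iInter_of_isSpreadable {t : ℝ} (ht0 : 0 < t) (ht1 : t < 1) {V : ℕ → Set ℝ}
    (hVo : ∀ j, IsOpen (V j)) (hV : ∀ j, IsSpreadable t (V j)) :
    ENNReal.ofReal t ≤ dimH (⋂ j, V j) := by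
  let Stage := {q : Set ℝ × Measure ℝ // IsCantorStage t q.1 q.2}
  have hstep : ∀ (j : ℕ) (q : Stage), ∃ q' : Stage,
      closure q'.1.1 ⊆ q.1.1 ∩ V j ∧ IsCompact (closure q'.1.1) := by
    rintro j ⟨q, hq⟩
    obtain ⟨O', μ', h, h1, h2⟩ := hq.exists_succ ht1 (hVo j) (hV j)
    exact ⟨⟨(O', μ'), h⟩, h1, h2⟩
  choose next hnext1 hnext2 using hstep
  let stage : ℕ → Stage := fun n =>
    Nat.rec (next 0 ⟨(_, _), IsCantorStage.restrict_Ioo ht0 ht1⟩) (fun j q => next j q) n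
  have hanti : Antitone fun n => closure (stage n).1.1 := antitone_nat_of_succ_le fun n =>
    ((hnext1 n (stage n)).trans inter_subset_left).trans subset_closure
  have hcomp : ∀ n, IsCompact (closure (stage n).1.1) := by
    rintro (_ | n)
    exacts [hnext2 _ _, hnext2 _ _]
  have hsub : (⋂ n, closure (stage n).1.1) ⊆ ⋂ j, V j := fun x hx => mem_iInter.2 fun j =>
    (hnext1 j (stage j) (mem_iInter.1 hx (j + 1))).2
  refine le_trans ?_ (dimH_mono hsub)
  refine le_dimH_of_hausdorffMeasure_ne_zero (d := t.toNNReal) fun h0 => ?_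
  rw [Real.coe_toNNReal _ ht0.le, Measure.hausdorffMeasure_apply] at h0
  have h1 := ENNReal.iSup_eq_zero.1 (ENNReal.iSup_eq_zero.1 h0 1) one_pos
  have h2 : (0:ℝ≥0∞) < 1 / 64 := by simp
  rw [← h1] at h2
  simp only [iInf_lt_iff] at h2
  obtain ⟨s, hs, -, hlt⟩ := h2
  have h3 := IsCantorStage.half_le_of_cover ht0 ht1 (fun n => (stage n).2) hanti hcomp hs
    (ε := 1 / 64) (by simp)
  have h4 : (1 / 2 : ℝ≥0∞) ≤ 4 * (1 / 64 + 1 / 64) := h3.trans (by gcongr)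
  have h5 := ENNReal.toReal_mono (by finiteness) h4
  rw [ENNReal.toReal_mul, ENNReal.toReal_add (by finiteness) (by finiteness)] at h5
  norm_num at h5

namespace ExpandingFullShift

variable (E : ExpandingFullShift)

theorem branch_subset (i : Fin E.g) : E.branch i ⊆ Ico 0 1 :=
  E.branch_cover ▸ subset_iUnion E.branch i

/-- A decreasing branch would attain a maximum, which `[0,1)` does not have. -/
theorem strictMonoOn_branch (i : Fin E.g) : StrictMonoOn E.f (E.branch i) := by
  refine (E.f_mono i).resolve_right fun hanti => ?_
  obtain ⟨a, b, hab, hi⟩ := E.branch_Ico i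
  have ha : a ∈ E.branch i := hi ▸ left_mem_Ico.2 hab
  have hfa : E.f a ∈ Ico (0:ℝ) 1 := E.f_onto i ▸ mem_image_of_mem E.f ha
  obtain ⟨y, hy, hy1⟩ := exists_between hfa.2
  obtain ⟨x, hx, rfl⟩ : y ∈ E.f '' E.branch i := E.f_onto i ▸ ⟨hfa.1.trans hy.le, hy1⟩
  exact absurd hy (hanti.antitoneOn ha hx (hi ▸ hx : x ∈ Ico a b).1).not_gt

theorem eq_of_mem_branch {i j : Fin E.g} {x : ℝ} (hi : x ∈ E.branch i) (hj : x ∈ E.branch j) :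
    i = j := by
  by_contra h
  exact Set.disjoint_left.1 (E.branch_disjoint i j h) hi hj

@[simp] theorem cylinder_nil : E.cylinder [] = Ico 0 1 := by
  ext x; simp [cylinder]

theorem mem_cylinder_cons {i : Fin E.g} {u : List (Fin E.g)} {x : ℝ} :
    x ∈ E.cylinder (i :: u) ↔ x ∈ E.branch i ∧ E.f x ∈ E.cylinder u := by
  constructor
  · rintro ⟨-, hx⟩
    have h0 : x ∈ E.branch i := hx 0 (by simp)
    refine ⟨h0, E.f_onto i ▸ mem_image_of_mem E.f h0, fun k hk => ?_⟩
    have := hx (k + 1) (by simpa using hk)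
    rwa [Function.iterate_succ_apply] at this
  · rintro ⟨h0, -, hx⟩
    refine ⟨E.branch_subset i h0, fun k hk => ?_⟩
    rcases k with _ | k
    · exact h0
    · rw [Function.iterate_succ_apply]
      exact hx k (by simpa using hk)

theorem cylinder_subset (u : List (Fin E.g)) : E.cylinder u ⊆ Ico 0 1 := fun _ hx => hx.1

theorem mem_cylinder_append {u v : List (Fin E.g)} {x : ℝ} :
    x ∈ E.cylinder (u ++ v) ↔ x ∈ E.cylinder u ∧ E.f^[u.length] x ∈ E.cylinder v := by
  induction u generalizing x with
  | nil => simpa using fun h => E.cylinder_subset v h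
  | cons i u ih =>
    rw [List.cons_append, mem_cylinder_cons, mem_cylinder_cons, ih, List.length_cons,
      Function.iterate_succ_apply, and_assoc]

theorem cylinder_append_subset (u v : List (Fin E.g)) : E.cylinder (u ++ v) ⊆ E.cylinder u :=
  fun _ hx => (E.mem_cylinder_append.1 hx).1

theorem exists_cylinder_eq_Ico (u : List (Fin E.g)) :
    ∃ a b : ℝ, a < b ∧ E.cylinder u = Ico a b := by
  induction u with
  | nil => exact ⟨0, 1, one_pos, E.cylinder_nil⟩
  | cons i u ih =>
    obtain ⟨a, b, hab, hu⟩ := ih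
    obtain ⟨c, d, hcd, hi⟩ := E.branch_Ico i
    have hmono := E.strictMonoOn_branch i
    have hsub : Ico a b ⊆ Ico 0 1 := hu ▸ E.cylinder_subset u
    obtain ⟨a', ha', rfl⟩ : a ∈ E.f '' E.branch i := E.f_onto i ▸ hsub (left_mem_Ico.2 hab)
    rcases lt_or_ge b 1 with hb | hb
    · obtain ⟨b', hb', rfl⟩ : b ∈ E.f '' E.branch i :=
        E.f_onto i ▸ ⟨(hsub (left_mem_Ico.2 hab)).1.trans hab.le, hb⟩
      refine ⟨a', b', (hmono.lt_iff_lt ha' hb').1 hab, ?_⟩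
      ext x
      rw [mem_cylinder_cons, hu]
      constructor
      · rintro ⟨hx, h1, h2⟩
        exact ⟨(hmono.le_iff_le ha' hx).1 h1, (hmono.lt_iff_lt hx hb').1 h2⟩
      · rintro ⟨h1, h2⟩
        have hx : x ∈ E.branch i := by
          rw [hi] at ha' hb' ⊢
          exact ⟨ha'.1.trans h1, h2.trans hb'.2⟩
        exact ⟨hx, (hmono.le_iff_le ha' hx).2 h1, (hmono.lt_iff_lt hx hb').2 h2⟩
    · refine ⟨a', d, (hi ▸ ha' : a' ∈ Ico c d).2, ?_⟩
      ext x
      rw [mem_cylinder_cons, hu]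
      constructor
      · rintro ⟨hx, h1, h2⟩
        exact ⟨(hmono.le_iff_le ha' hx).1 h1, (hi ▸ hx : x ∈ Ico c d).2⟩
      · rintro ⟨h1, h2⟩
        have hx : x ∈ E.branch i := by
          rw [hi] at ha' ⊢
          exact ⟨ha'.1.trans h1, h2⟩
        have hfx : E.f x ∈ Ico (0:ℝ) 1 := E.f_onto i ▸ mem_image_of_mem E.f hx
        exact ⟨hx, (hmono.le_iff_le ha' hx).2 h1, hfx.2.trans_le hb⟩

theorem exists_iterate_eq (u : List (Fin E.g)) {y : ℝ} (hy : y ∈ Ico (0:ℝ) 1) :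
    ∃ x ∈ E.cylinder u, E.f^[u.length] x = y := by
  induction u with
  | nil => exact ⟨y, by simpa using hy, rfl⟩
  | cons i u ih =>
    obtain ⟨z, hz, rfl⟩ := ih
    obtain ⟨x, hx, rfl⟩ : z ∈ E.f '' E.branch i := E.f_onto i ▸ E.cylinder_subset u hz
    exact ⟨x, E.mem_cylinder_cons.2 ⟨hx, hz⟩, rfl⟩

theorem exists_mem_cylinder_of_length {x : ℝ} (hx : x ∈ Ico (0:ℝ) 1) (n : ℕ) :
    ∃ u : List (Fin E.g), u.length = n ∧ x ∈ E.cylinder u := by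
  induction n generalizing x with
  | zero => exact ⟨[], rfl, by simpa using hx⟩
  | succ n ih =>
    obtain ⟨i, hi⟩ := mem_iUnion.1 (E.branch_cover ▸ hx)
    obtain ⟨u, hu, hfx⟩ := ih (E.f_onto i ▸ mem_image_of_mem E.f hi)
    exact ⟨i :: u, by simp [hu], E.mem_cylinder_cons.2 ⟨hi, hfx⟩⟩

theorem exists_eq_append_of_mem {u v : List (Fin E.g)} {x : ℝ} (hu : x ∈ E.cylinder u)
    (hv : x ∈ E.cylinder v) (huv : u.length ≤ v.length) : ∃ w, v = u ++ w := by
  induction u generalizing x v with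
  | nil => exact ⟨v, rfl⟩
  | cons i u ih =>
    rcases v with _ | ⟨j, v⟩
    · simp at huv
    · rw [mem_cylinder_cons] at hu hv
      obtain ⟨w, rfl⟩ := ih hu.2 hv.2 (by simpa using huv)
      exact ⟨w, by rw [E.eq_of_mem_branch hu.1 hv.1, List.cons_append]⟩

theorem eq_of_mem_cylinder {u v : List (Fin E.g)} {x : ℝ} (hu : x ∈ E.cylinder u)
    (hv : x ∈ E.cylinder v) (huv : u.length = v.length) : u = v := by
  obtain ⟨w, rfl⟩ := E.exists_eq_append_of_mem hu hv huv.le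
  have : w = [] := by simpa using huv
  simp [this]

theorem measurableSet_cylinder (u : List (Fin E.g)) : MeasurableSet (E.cylinder u) := by
  obtain ⟨a, b, -, h⟩ := E.exists_cylinder_eq_Ico u
  exact h ▸ measurableSet_Ico

/-- The length of a cylinder. -/
def len (u : List (Fin E.g)) : ℝ≥0∞ := volume (E.cylinder u)

theorem len_pos (u : List (Fin E.g)) : E.len u ≠ 0 := by
  obtain ⟨a, b, hab, h⟩ := E.exists_cylinder_eq_Ico u
  simp [len, h, hab]

theorem len_ne_top (u : List (Fin E.g)) : E.len u ≠ ⊤ := by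
  obtain ⟨a, b, hab, h⟩ := E.exists_cylinder_eq_Ico u
  simp [len, h]

@[simp] theorem len_nil : E.len [] = 1 := by simp [len]

theorem len_append_le (u v : List (Fin E.g)) : E.len (u ++ v) ≤ E.len u :=
  measure_mono (E.cylinder_append_subset u v)

theorem ediam_cylinder (u : List (Fin E.g)) : Metric.ediam (E.cylinder u) = E.len u := by
  obtain ⟨a, b, hab, h⟩ := E.exists_cylinder_eq_Ico u
  simp [len, h, Real.ediam_Ico]

theorem disjoint_cylinder_append {u : List (Fin E.g)} {i j : Fin E.g} (hij : i ≠ j) :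
    Disjoint (E.cylinder (u ++ [i])) (E.cylinder (u ++ [j])) :=
  Set.disjoint_left.2 fun _ hi hj => hij (by
    simpa using E.eq_of_mem_cylinder hi hj (by simp))

/-- Passing to a child changes the length of a cylinder by a factor in `[ρ, 1 - ρ]`. -/
structure IsRatio (ρ : ℝ) : Prop where
  pos : 0 < ρ
  lt_one : ρ < 1
  le_len : ∀ u i, ENNReal.ofReal ρ * E.len u ≤ E.len (u ++ [i])
  len_le : ∀ u i, E.len (u ++ [i]) ≤ ENNReal.ofReal (1 - ρ) * E.len u

theorem HasBoundedDistortion.exists_isRatio {E : ExpandingFullShift} {K : ℝ} (hK1 : 1 ≤ K)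
    (hK : E.HasBoundedDistortion K) : ∃ ρ, E.IsRatio ρ := by
  have hg := E.one_lt_g
  have : Nonempty (Fin E.g) := ⟨E.zeroSym⟩
  obtain ⟨j, hj⟩ := Finite.exists_min fun i : Fin E.g => E.len [i]
  set L : List (Fin E.g) → ℝ := fun u => (E.len u).toReal with hL
  have hLpos : ∀ u, 0 < L u := fun u => ENNReal.toReal_pos (E.len_pos u) (E.len_ne_top u)
  have hLof : ∀ u, ENNReal.ofReal (L u) = E.len u := fun u => ENNReal.ofReal_toReal (E.len_ne_top u)
  have hKpos : 0 < K := by linarith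
  set ρ := L [j] / K with hρ
  have hρpos : 0 < ρ := div_pos (hLpos _) hKpos
  have hlow : ∀ u i, ρ * L u ≤ L (u ++ [i]) := by
    intro u i
    have h1 : E.len u * E.len [i] ≤ ENNReal.ofReal K * E.len (u ++ [i]) := (hK u [i]).2
    have h2 : E.len u * E.len [j] ≤ ENNReal.ofReal K * E.len (u ++ [i]) :=
      (mul_le_mul_right (hj i) _).trans h1
    have h3 := ENNReal.toReal_mono (ENNReal.mul_ne_top (by simp) (E.len_ne_top _)) h2
    rw [ENNReal.toReal_mul, ENNReal.toReal_mul, ENNReal.toReal_ofReal hKpos.le] at h3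
    rw [hρ, div_mul_eq_mul_div, div_le_iff₀ hKpos]
    linarith
  have hhigh : ∀ u i, L (u ++ [i]) ≤ (1 - ρ) * L u := by
    intro u i
    have : Nontrivial (Fin E.g) := Fin.nontrivial_iff_two_le.2 hg
    obtain ⟨i', hi'⟩ := exists_ne i
    have h1 : E.len (u ++ [i]) + E.len (u ++ [i']) ≤ E.len u := by
      rw [len, len, ← measure_union (E.disjoint_cylinder_append hi'.symm)
        (E.measurableSet_cylinder _)]
      exact measure_mono (union_subset (E.cylinder_append_subset _ _)
        (E.cylinder_append_subset _ _))
    have h2 := ENNReal.toReal_mono (E.len_ne_top _) h1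
    rw [ENNReal.toReal_add (E.len_ne_top _) (E.len_ne_top _)] at h2
    have h3 := hlow u i'
    simp only [hL] at h3 ⊢
    linarith
  have hρ1 : ρ < 1 := by
    by_contra! h
    have h1 := hhigh [] j
    have h2 := hLpos ([] ++ [j])
    nlinarith [hLpos []]
  refine ⟨ρ, hρpos, hρ1, fun u i => ?_, fun u i => ?_⟩
  · rw [← hLof, ← hLof, ← ENNReal.ofReal_mul hρpos.le]
    exact ENNReal.ofReal_le_ofReal (hlow u i)
  · rw [← hLof, ← hLof, ← ENNReal.ofReal_mul (by linarith)]
    exact ENNReal.ofReal_le_ofReal (hhigh u i)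

variable {E}

theorem IsRatio.len_le_pow {ρ : ℝ} (h : E.IsRatio ρ) (u : List (Fin E.g)) :
    E.len u ≤ ENNReal.ofReal (1 - ρ) ^ u.length := by
  induction u using List.reverseRecOn with
  | nil => simp
  | append_singleton u i ih =>
    rw [List.length_append, List.length_singleton, pow_succ']
    exact (h.len_le u i).trans (by gcongr)

theorem IsRatio.exists_len_le {ρ : ℝ} (h : E.IsRatio ρ) {δ : ℝ≥0∞} (hδ : δ ≠ 0) :
    ∃ n : ℕ, ∀ u : List (Fin E.g), u.length = n → E.len u ≤ δ := by
  have hlt : ENNReal.ofReal (1 - ρ) < 1 := by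
    rw [ENNReal.ofReal_lt_one]; linarith [h.pos]
  obtain ⟨n, hn⟩ := ((ENNReal.tendsto_pow_atTop_nhds_zero_of_lt_one hlt).eventually
    (gt_mem_nhds (pos_iff_ne_zero.2 hδ))).exists
  exact ⟨n, fun u hu => (h.len_le_pow u).trans (hu ▸ hn.le)⟩

end ExpandingFullShift

theorem ENNReal.rpow_sub_one_mul_self {a : ℝ≥0∞} (h0 : a ≠ 0) (ht : a ≠ ⊤) (t : ℝ) :
    a ^ (t - 1) * a = a ^ t := by
  nth_rw 2 [← ENNReal.rpow_one a]
  rw [← ENNReal.rpow_add _ _ h0 ht, sub_add_cancel]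

theorem ENNReal.rpow_le_rpow_of_nonpos {a b : ℝ≥0∞} (hab : a ≤ b) {z : ℝ} (hz : z ≤ 0) :
    b ^ z ≤ a ^ z := by
  rw [← neg_neg z, ENNReal.rpow_neg, ENNReal.rpow_neg a]
  exact ENNReal.inv_le_inv.2 (ENNReal.rpow_le_rpow hab (by linarith))

namespace ExpandingFullShift

variable {E : ExpandingFullShift} {t ρ : ℝ}

/-- A measure on `[0,1)` with a Frostman condition on cylinders satisfies one on all intervals. -/
theorem IsRatio.frostman (h : E.IsRatio ρ) (ht0 : 0 < t) (ht1 : t < 1) {ν : Measure ℝ}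
    (hν0 : ν (Ico 0 1)ᶜ = 0) {c : ℝ≥0∞} (hν : ∀ v, ν (E.cylinder v) ≤ c * E.len v ^ t) (x y : ℝ) :
    ν (Ico x y) ≤ c * (ENNReal.ofReal ρ ^ (t - 1) * 3) * volume (Ico x y) ^ t := by
  rcases le_or_gt y x with hxy | hxy
  · simp [Ico_eq_empty_of_le hxy]
  set l : ℝ≥0∞ := volume (Ico x y) with hl
  have hlval : l = ENNReal.ofReal (y - x) := Real.volume_Ico
  have hl0 : l ≠ 0 := by rw [hlval]; simpa using hxy
  have hltop : l ≠ ⊤ := by rw [hlval]; simp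
  have hB : ν (Ico x y) ≤ ν (Ico x y ∩ Ico 0 1) := by
    have h0 : ν (Ico x y \ Ico 0 1) = 0 := measure_mono_null (fun z hz => hz.2) hν0
    simpa [h0] using measure_le_inter_add_sdiff ν (Ico x y) (Ico 0 1)
  rcases le_or_gt 1 l with hl1 | hl1
  · have h1 : (1:ℝ≥0∞) ≤ ENNReal.ofReal ρ ^ (t - 1) * 3 := by
      refine one_le_mul ?_ (by norm_num)
      exact ENNReal.one_le_rpow_of_pos_of_le_one_of_neg (by simpa using h.pos)
        (by simpa using h.lt_one.le) (by linarith)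
    calc ν (Ico x y) ≤ ν (E.cylinder []) := by
          rw [E.cylinder_nil]; exact hB.trans (measure_mono inter_subset_right)
      _ ≤ c * E.len [] ^ t := hν []
      _ = c * 1 * 1 := by simp
      _ ≤ c * (ENNReal.ofReal ρ ^ (t - 1) * 3) * l ^ t := by
          gcongr
          exact ENNReal.one_le_rpow hl1 ht0
  set F : Set (List (Fin E.g)) :=
    {v | E.len v ≤ l ∧ l < E.len v.dropLast ∧ (E.cylinder v ∩ Ico x y).Nonempty} with hF
  have hcover : Ico x y ∩ Ico 0 1 ⊆ ⋃ v : F, E.cylinder v := by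
    rintro z ⟨hz, hz1⟩
    have key : ∀ v : List (Fin E.g), z ∈ E.cylinder v → E.len v ≤ l →
        ∃ v' : List (Fin E.g), z ∈ E.cylinder v' ∧ E.len v' ≤ l ∧ l < E.len v'.dropLast := by
      intro v
      induction v using List.reverseRecOn with
      | nil => intro _ hv; exact absurd hv (by simpa using hl1)
      | append_singleton u i ih =>
        intro hz hv
        by_cases hu : E.len u ≤ l
        · exact ih (E.cylinder_append_subset _ _ hz) hu
        · exact ⟨u ++ [i], hz, hv, by simpa using hu⟩
    obtain ⟨n, hn⟩ := h.exists_len_le hl0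
    obtain ⟨v, hvn, hzv⟩ := E.exists_mem_cylinder_of_length hz1 n
    obtain ⟨v', h1, h2, h3⟩ := key v hzv (hn v hvn)
    exact mem_iUnion.2 ⟨⟨v', h2, h3, z, h1, hz⟩, h1⟩
  have hdisj : Pairwise (Function.onFun Disjoint fun v : F => E.cylinder v) := by
    have key : ∀ u ∈ F, ∀ v ∈ F, ∀ z ∈ E.cylinder u, z ∈ E.cylinder v → u.length ≤ v.length →
        u = v := by
      intro u hu v hv z hzu hzv huv
      obtain ⟨w, rfl⟩ := E.exists_eq_append_of_mem hzu hzv huv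
      rcases w.eq_nil_or_concat with rfl | ⟨w, i, rfl⟩
      · simp
      · have h2 := hv.2.1
        rw [List.concat_eq_append, ← List.append_assoc, List.dropLast_concat] at h2
        exact absurd ((E.len_append_le u w).trans hu.1) h2.not_ge
    rintro ⟨u, hu⟩ ⟨v, hv⟩ huv
    refine Set.disjoint_left.2 fun z hzu hzv => huv (Subtype.ext ?_)
    rcases le_total u.length v.length with hle | hle
    · exact key u hu v hv z hzu hzv hle
    · exact (key v hv u hu z hzv hzu hle).symm
  have hsum : ∑' v : F, E.len v ≤ 3 * l := by
    have : ∑' v : F, E.len v = volume (⋃ v : F, E.cylinder v) :=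
      (measure_iUnion hdisj fun v => E.measurableSet_cylinder v).symm
    rw [this]
    calc volume (⋃ v : F, E.cylinder v) ≤ volume (Ico (x - (y - x)) (y + (y - x))) := by
          refine measure_mono (iUnion_subset fun ⟨v, hv, _, z, hz, hzB⟩ w hw => ?_)
          obtain ⟨a, b, hab, heq⟩ := E.exists_cylinder_eq_Ico v
          rw [heq] at hz hw
          rw [len, heq, Real.volume_Ico, hlval, ENNReal.ofReal_le_ofReal_iff (by linarith)] at hv
          constructor <;> linarith [hz.1, hz.2, hw.1, hw.2, hzB.1, hzB.2]
      _ = 3 * l := by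
          rw [Real.volume_Ico, hlval, show y + (y - x) - (x - (y - x)) = 3 * (y - x) by ring,
            ENNReal.ofReal_mul (by norm_num)]
          simp
  calc ν (Ico x y) ≤ ν (⋃ v : F, E.cylinder v) := hB.trans (measure_mono hcover)
    _ ≤ ∑' v : F, ν (E.cylinder v) := measure_iUnion_le _
    _ ≤ ∑' v : F, c * (ENNReal.ofReal ρ * l) ^ (t - 1) * E.len v := by
        refine ENNReal.tsum_le_tsum fun ⟨v, hv⟩ => (hν v).trans ?_
        rw [mul_assoc]
        refine mul_le_mul_right ?_ c
        have hge : ENNReal.ofReal ρ * l ≤ E.len v := by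
          rcases v.eq_nil_or_concat with rfl | ⟨w, i, rfl⟩
          · exact absurd hv.1 (by simpa using hl1)
          · rw [List.concat_eq_append]
            have h2 := hv.2.1
            rw [List.concat_eq_append, List.dropLast_concat] at h2
            exact (mul_le_mul_right h2.le _).trans (h.le_len w i)
        calc E.len v ^ t = E.len v ^ (t - 1) * E.len v := 
              (ENNReal.rpow_sub_one_mul_self (E.len_pos v) (E.len_ne_top v) t).symm
          _ ≤ (ENNReal.ofReal ρ * l) ^ (t - 1) * E.len v := by
              refine mul_le_mul_left ?_ _
              exact ENNReal.rpow_le_rpow_of_nonpos hge (by linarith)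
    _ = c * (ENNReal.ofReal ρ * l) ^ (t - 1) * ∑' v : F, E.len v := ENNReal.tsum_mul_left
    _ ≤ c * (ENNReal.ofReal ρ * l) ^ (t - 1) * (3 * l) := by gcongr
    _ = c * (ENNReal.ofReal ρ ^ (t - 1) * 3) * (l ^ (t - 1) * l) := by
        rw [ENNReal.mul_rpow_of_ne_top (by simp) hltop]; ring
    _ = c * (ENNReal.ofReal ρ ^ (t - 1) * 3) * l ^ t := by
        rw [ENNReal.rpow_sub_one_mul_self hl0 hltop]

end ExpandingFullShift

theorem ENNReal.exists_le_sum_eq {ι : Type*} [Fintype ι] {a : ℝ≥0∞} {b : ι → ℝ≥0∞}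
    (hb : ∑ i, b i ≠ ⊤) (h : a ≤ ∑ i, b i) : ∃ c : ι → ℝ≥0∞, (∀ i, c i ≤ b i) ∧ ∑ i, c i = a := by
  rcases eq_or_ne (∑ i, b i) 0 with h0 | h0
  · exact ⟨0, by simp, by simpa using (le_zero_iff.1 (h0 ▸ h)).symm⟩
  · refine ⟨fun i => a / (∑ i, b i) * b i, fun i => ?_, ?_⟩
    · exact mul_le_of_le_one_left' (ENNReal.div_le_of_le_mul (by simpa using h))
    · rw [← Finset.mul_sum, ENNReal.div_mul_cancel h0 hb]

theorem ENNReal.tsum_iUnion_le_of_monotone {α : Type*} {S : ℕ → Set α} (hS : Monotone S)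
    {f : α → ℝ≥0∞} {b : ℝ≥0∞} (h : ∀ n, ∑' v : S n, f v ≤ b) : ∑' v : ⋃ n, S n, f v ≤ b := by
  rw [ENNReal.tsum_eq_iSup_sum]
  refine iSup_le fun s => ?_
  choose N hN using fun v : ⋃ n, S n => mem_iUnion.1 v.2
  have hsub : (↑(s.map (Function.Embedding.subtype _)) : Set α) ⊆ S (s.sup N) := by
    intro v hv
    obtain ⟨w, hw, rfl⟩ := Finset.mem_map.1 (Finset.mem_coe.1 hv)
    exact hS (Finset.le_sup hw) (hN w)
  calc ∑ v ∈ s, f v = ∑ v ∈ s.map (Function.Embedding.subtype _), f v := by simp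
    _ = ∑' v : (↑(s.map (Function.Embedding.subtype _)) : Set α), f v :=
        (Finset.tsum_subtype' _ f).symm
    _ ≤ ∑' v : S (s.sup N), f v := ENNReal.tsum_mono_subtype f hsub
    _ ≤ b := h _

namespace ExpandingFullShift

variable {E : ExpandingFullShift} {t : ℝ} {V : Set ℝ}

variable (E t V) in
/-- The `t`-content of `V ∩ C_u` computed from the cylinders of depth at most `d` below `u` which
are contained in `V`. -/
def treeContent : ℕ → List (Fin E.g) → ℝ≥0∞
  | 0, u => if E.cylinder u ⊆ V then E.len u ^ t else 0
  | d + 1, u => if E.cylinder u ⊆ V then E.len u ^ t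
      else min (E.len u ^ t) (∑ i, treeContent d (u ++ [i]))

theorem treeContent_of_subset {u : List (Fin E.g)} (h : E.cylinder u ⊆ V) (d : ℕ) :
    E.treeContent t V d u = E.len u ^ t := by
  cases d <;> simp [treeContent, h]

theorem treeContent_le (d : ℕ) (u : List (Fin E.g)) : E.treeContent t V d u ≤ E.len u ^ t := by
  cases d <;> rw [treeContent] <;> split_ifs <;> simp

theorem monotone_treeContent (u : List (Fin E.g)) : Monotone fun d => E.treeContent t V d u := by
  refine monotone_nat_of_le_succ fun d => ?_
  induction d generalizing u with
  | zero =>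
    by_cases h : E.cylinder u ⊆ V <;> simp [treeContent, h]
  | succ d ih =>
    by_cases h : E.cylinder u ⊆ V
    · simp [treeContent, h]
    · rw [treeContent, treeContent, if_neg h, if_neg h]
      exact min_le_min_left _ (Finset.sum_le_sum fun i _ => ih _)

variable (E t V) in
/-- The limit of `treeContent` as the depth tends to infinity. -/
def limContent (u : List (Fin E.g)) : ℝ≥0∞ := ⨆ d, E.treeContent t V d u

theorem limContent_of_subset {u : List (Fin E.g)} (h : E.cylinder u ⊆ V) :
    E.limContent t V u = E.len u ^ t := by
  simp [limContent, treeContent_of_subset h]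

theorem sum_limContent_le {u : List (Fin E.g)} (h : E.limContent t V u ≠ E.len u ^ t) :
    ∑ i, E.limContent t V (u ++ [i]) ≤ E.limContent t V u := by
  have hlt : E.limContent t V u < E.len u ^ t :=
    lt_of_le_of_ne (iSup_le fun d => treeContent_le d u) h
  simp only [limContent]
  rw [ENNReal.finsetSum_iSup_of_monotone fun i => monotone_treeContent _]
  refine iSup_mono' fun d => ⟨d + 1, ?_⟩
  have h1 : E.treeContent t V (d + 1) u < E.len u ^ t :=
    (le_iSup (fun d => E.treeContent t V d u) (d + 1)).trans_lt hlt
  rw [treeContent, if_neg fun h' => h (limContent_of_subset h')] at h1 ⊢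
  exact le_min ((min_lt_iff.1 h1).resolve_left (lt_irrefl _)).le le_rfl

theorem exists_measure_of_subset (ht0 : 0 < t) (ht1 : t < 1) {u : List (Fin E.g)}
    (hu : E.cylinder u ⊆ V) {a : ℝ≥0∞} (ha : a ≤ E.len u ^ t) :
    ∃ ν : Measure ℝ, ν univ = a ∧ ν (E.cylinder u ∩ interior V)ᶜ = 0 ∧
      (∃ D : ℝ≥0∞, D ≠ ⊤ ∧ ∀ s, ν s ≤ D * volume s) ∧ ∀ v, ν (E.cylinder v) ≤ E.len v ^ t := by
  have hatop : a ≠ ⊤ :=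
    (ha.trans_lt (ENNReal.rpow_lt_top_of_nonneg ht0.le (E.len_ne_top u))).ne
  refine ⟨(a / E.len u) • volume.restrict (E.cylinder u), ?_, ?_,
    ⟨a / E.len u, ENNReal.div_ne_top hatop (E.len_pos u), fun s => ?_⟩, fun v => ?_⟩
  · rw [Measure.smul_apply, Measure.restrict_apply_univ, smul_eq_mul]
    exact ENNReal.div_mul_cancel (E.len_pos u) (E.len_ne_top u)
  · obtain ⟨x, y, hxy, huxy⟩ := E.exists_cylinder_eq_Ico u
    have hint : Ioo x y ⊆ interior V :=
      interior_maximal (Ioo_subset_Ico_self.trans (huxy ▸ hu)) isOpen_Ioo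
    rw [Measure.smul_apply, Measure.restrict_apply' (E.measurableSet_cylinder u)]
    refine smul_eq_zero_of_right _ (measure_mono_null (t := {x}) ?_ (by simp))
    rintro z ⟨hz1, hz2⟩
    rw [huxy] at hz1 hz2
    by_contra hzx
    exact hz1 ⟨hz2, hint ⟨lt_of_le_of_ne hz2.1 (Ne.symm hzx), hz2.2⟩⟩
  · rw [Measure.smul_apply, smul_eq_mul]
    gcongr
    exact Measure.restrict_le_self
  · rw [Measure.smul_apply, Measure.restrict_apply (E.measurableSet_cylinder v), smul_eq_mul]
    set s := volume (E.cylinder v ∩ E.cylinder u)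
    have hsu : s ≤ E.len u := measure_mono inter_subset_right
    have hsv : s ≤ E.len v := measure_mono inter_subset_left
    rcases eq_or_ne s 0 with hs | hs
    · simp [hs]
    calc a / E.len u * s ≤ E.len u ^ (t - 1) * s := by
          gcongr
          refine ENNReal.div_le_of_le_mul ?_
          rwa [ENNReal.rpow_sub_one_mul_self (E.len_pos u) (E.len_ne_top u)]
      _ ≤ s ^ (t - 1) * s := by
          refine mul_le_mul_left ?_ _
          exact ENNReal.rpow_le_rpow_of_nonpos hsu (by linarith)
      _ = s ^ t := ENNReal.rpow_sub_one_mul_self hs (ne_top_of_le_ne_top (E.len_ne_top u) hsu) t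
      _ ≤ E.len v ^ t := ENNReal.rpow_le_rpow hsv ht0.le

theorem exists_measure_of_le_treeContent (ht0 : 0 < t) (ht1 : t < 1) (d : ℕ)
    (u : List (Fin E.g)) {a : ℝ≥0∞} (ha : a ≤ E.treeContent t V d u) :
    ∃ ν : Measure ℝ, ν univ = a ∧ ν (E.cylinder u ∩ interior V)ᶜ = 0 ∧
      (∃ D : ℝ≥0∞, D ≠ ⊤ ∧ ∀ s, ν s ≤ D * volume s) ∧ ∀ v, ν (E.cylinder v) ≤ E.len v ^ t := by
  by_cases hu : E.cylinder u ⊆ V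
  · exact exists_measure_of_subset ht0 ht1 hu (treeContent_of_subset hu d ▸ ha)
  induction d generalizing u a with
  | zero =>
    rw [treeContent, if_neg hu, le_zero_iff] at ha
    exact ⟨0, by simp [ha], by simp, ⟨0, by simp, by simp⟩, by simp⟩
  | succ d ih =>
    have hau := ha.trans (treeContent_le _ u)
    rw [treeContent, if_neg hu, le_min_iff] at ha
    obtain ⟨c, hc, rfl⟩ := ENNReal.exists_le_sum_eq (ENNReal.sum_ne_top.2 fun i _ =>
      ((treeContent_le d (u ++ [i])).trans_lt
        (ENNReal.rpow_lt_top_of_nonneg ht0.le (E.len_ne_top _))).ne) ha.2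
    have hex : ∀ i, ∃ ν : Measure ℝ, ν univ = c i ∧
        ν (E.cylinder (u ++ [i]) ∩ interior V)ᶜ = 0 ∧
        (∃ D : ℝ≥0∞, D ≠ ⊤ ∧ ∀ s, ν s ≤ D * volume s) ∧
        ∀ v, ν (E.cylinder v) ≤ E.len v ^ t := by
      intro i
      by_cases hi : E.cylinder (u ++ [i]) ⊆ V
      · exact exists_measure_of_subset ht0 ht1 hi ((hc i).trans (treeContent_le _ _))
      · exact ih _ (hc i) hi
    choose ν hν1 hν0 hνD hνt using hex
    choose D hD hνD using hνD
    have huniv : (∑ i, ν i) univ = ∑ i, c i := by simp [Measure.finsetSum_apply, hν1]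
    have hcompl : (∑ i, ν i) (E.cylinder u ∩ interior V)ᶜ = 0 := by
      rw [Measure.finsetSum_apply]
      exact Finset.sum_eq_zero fun i _ => measure_mono_null (compl_subset_compl.2
        (inter_subset_inter_left _ (E.cylinder_append_subset _ _))) (hν0 i)
    refine ⟨∑ i, ν i, huniv, hcompl, ⟨∑ i, D i, ENNReal.sum_ne_top.2 fun i _ => hD i,
      fun s => ?_⟩, fun v => ?_⟩
    · rw [Measure.finsetSum_apply, Finset.sum_mul]
      exact Finset.sum_le_sum fun i _ => hνD i s
    · by_cases huv : (E.cylinder u ∩ E.cylinder v).Nonempty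
      · obtain ⟨z, hzu, hzv⟩ := huv
        rcases le_or_gt v.length u.length with hle | hlt
        · obtain ⟨w, rfl⟩ := E.exists_eq_append_of_mem hzv hzu hle
          calc (∑ i, ν i) (E.cylinder v) ≤ (∑ i, ν i) univ := measure_mono (subset_univ _)
            _ ≤ E.len (v ++ w) ^ t := huniv ▸ hau
            _ ≤ E.len v ^ t := ENNReal.rpow_le_rpow (E.len_append_le _ _) ht0.le
        · obtain ⟨w, rfl⟩ := E.exists_eq_append_of_mem hzu hzv hlt.le
          rcases w with _ | ⟨i, w⟩
          · simp at hlt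
          rw [Measure.finsetSum_apply, Finset.sum_eq_single i]
          · exact hνt i _
          · intro j _ hji
            refine measure_mono_null (t := (E.cylinder (u ++ [j]) ∩ interior V)ᶜ)
              (fun x hx (hx' : x ∈ _ ∩ _) => ?_) (hν0 j)
            rw [show u ++ i :: w = u ++ [i] ++ w by simp] at hx
            exact Set.disjoint_left.1 (E.disjoint_cylinder_append hji) hx'.1
              (E.cylinder_append_subset _ _ hx)
          · simp
      · rw [measure_mono_null (fun x hx (hx' : x ∈ E.cylinder u ∩ interior V) => huv ⟨x, hx'.1, hx⟩) hcompl]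
        exact zero_le

variable (E t V) in
/-- The first words extending `u` by at most `n` symbols whose full content is attained. -/
def stopWords : ℕ → List (Fin E.g) → Set (List (Fin E.g))
  | 0, u => if E.limContent t V u = E.len u ^ t then {u} else ∅
  | n + 1, u => if E.limContent t V u = E.len u ^ t then {u} else ⋃ i, stopWords n (u ++ [i])

theorem monotone_stopWords (u : List (Fin E.g)) : Monotone fun n => E.stopWords t V n u := by
  refine monotone_nat_of_le_succ fun n => ?_
  induction n generalizing u with
  | zero => by_cases h : E.limContent t V u = E.len u ^ t <;> simp [stopWords, h]
  | succ n ih =>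
    by_cases h : E.limContent t V u = E.len u ^ t
    · simp [stopWords, h]
    · rw [stopWords, stopWords, if_neg h, if_neg h]
      exact iUnion_mono fun i => ih _

theorem exists_eq_append_of_mem_stopWords {n : ℕ} {u w : List (Fin E.g)}
    (h : w ∈ E.stopWords t V n u) : ∃ v, w = u ++ v := by
  induction n generalizing u with
  | zero =>
    rw [stopWords] at h
    split_ifs at h
    · exact ⟨[], by simpa using h⟩
    · exact h.elim
  | succ n ih =>
    rw [stopWords] at h
    split_ifs at h
    · exact ⟨[], by simpa using h⟩
    · obtain ⟨i, hi⟩ := mem_iUnion.1 h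
      obtain ⟨v, rfl⟩ := ih hi
      exact ⟨i :: v, by simp⟩

theorem tsum_stopWords_le (n : ℕ) (u : List (Fin E.g)) :
    ∑' v : E.stopWords t V n u, E.len v ^ t ≤ E.limContent t V u := by
  have hself : ∀ u : List (Fin E.g),
      ∑' v : ({u} : Set (List (Fin E.g))), E.len v ^ t = E.len u ^ t :=
    fun u => tsum_singleton u fun v => E.len v ^ t
  induction n generalizing u with
  | zero =>
    by_cases h : E.limContent t V u = E.len u ^ t
    · rw [stopWords, if_pos h, hself, h]
    · rw [stopWords, if_neg h]; simp
  | succ n ih =>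
    by_cases h : E.limContent t V u = E.len u ^ t
    · rw [stopWords, if_pos h, hself, h]
    · rw [stopWords, if_neg h]
      exact (ENNReal.tsum_iUnion_le (fun v => E.len v ^ t) _).trans
        ((Finset.sum_le_sum fun i _ => ih _).trans (sum_limContent_le h))

theorem exists_mem_stopWords {u v : List (Fin E.g)} {x : ℝ} (hx : x ∈ E.cylinder (u ++ v))
    (hv : E.cylinder (u ++ v) ⊆ V) : ∃ w ∈ E.stopWords t V v.length u, x ∈ E.cylinder w := by
  induction v generalizing u with
  | nil =>
    rw [List.append_nil] at hx hv
    exact ⟨u, by simp [stopWords, limContent_of_subset hv], hx⟩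
  | cons i v ih =>
    by_cases h : E.limContent t V u = E.len u ^ t
    · exact ⟨u, by simp [stopWords, h], E.cylinder_append_subset _ _ hx⟩
    · rw [show u ++ i :: v = u ++ [i] ++ v by simp] at hx hv
      obtain ⟨w, hw, hxw⟩ := ih hx hv
      refine ⟨w, ?_, hxw⟩
      rw [List.length_cons, stopWords, if_neg h]
      exact mem_iUnion.2 ⟨i, hw⟩

theorem exists_le_tsum_of_lt_dimH {t : ℝ} (ht0 : 0 < t) {A : Set ℝ}
    (hA : ENNReal.ofReal t < dimH A) :
    ∃ c : ℝ≥0∞, c ≠ 0 ∧ ∀ S : Set (List (Fin E.g)), A ⊆ ⋃ v ∈ S, E.cylinder v →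
      c ≤ ∑' v : S, E.len v ^ t := by
  by_contra! hcon
  choose S hcov hS using fun n : ℕ => hcon ((n : ℝ≥0∞)⁻¹) (by simp)
  have htend : Tendsto (fun n : ℕ => ((n : ℝ≥0∞)⁻¹) ^ t⁻¹) atTop (nhds 0) := by
    have := (ENNReal.continuous_rpow_const (y := t⁻¹)).continuousAt.tendsto.comp
      ENNReal.tendsto_inv_nat_nhds_zero
    rwa [ENNReal.zero_rpow_of_pos (inv_pos.2 ht0)] at this
  have hle : μH[t] A ≤ 0 := by
    calc μH[t] A ≤ liminf (fun n => ∑' v : S n, Metric.ediam (E.cylinder v) ^ t) atTop := by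
          refine Measure.hausdorffMeasure_le_liminf_tsum t A _ htend
            (fun n (v : S n) => E.cylinder v) (Eventually.of_forall fun n v => ?_)
            (Eventually.of_forall fun n => ?_)
          · rw [E.ediam_cylinder, ENNReal.le_rpow_inv_iff ht0]
            exact (ENNReal.le_tsum v).trans (hS n).le
          · rw [← biUnion_eq_iUnion (S n) fun v _ => E.cylinder v]
            exact hcov n
      _ ≤ liminf (fun n : ℕ => (n : ℝ≥0∞)⁻¹) atTop := by
          refine liminf_le_liminf (Eventually.of_forall fun n => ?_)
          simp only [E.ediam_cylinder]
          exact (hS n).le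
      _ = 0 := ENNReal.tendsto_inv_nat_nhds_zero.liminf_eq
  have htop : μH[((t.toNNReal : NNReal) : ℝ)] A = ⊤ := hausdorffMeasure_of_lt_dimH hA
  rw [Real.coe_toNNReal _ ht0.le] at htop
  simp [htop] at hle

/-- A cylinder has content comparable to its length: the content lower bound for an invariant set
is transported to every cylinder by bounded distortion. -/
theorem mul_rpow_le_limContent (ht0 : 0 < t) {K : ℝ} (hK : E.HasBoundedDistortion K)
    {A : Set ℝ} (hA1 : A ⊆ Ico 0 1) (hAV : A ⊆ V)
    (hV : ∀ x ∈ V, ∃ w, x ∈ E.cylinder w ∧ E.cylinder w ⊆ V)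
    (hAinv : ∀ u, ∀ x ∈ E.cylinder u, E.f^[u.length] x ∈ A → x ∈ A) {c : ℝ≥0∞}
    (hc : ∀ S : Set (List (Fin E.g)), A ⊆ ⋃ v ∈ S, E.cylinder v → c ≤ ∑' v : S, E.len v ^ t)
    (u : List (Fin E.g)) :
    c * E.len u ^ t ≤ ENNReal.ofReal K ^ t * E.limContent t V u := by
  set T := ⋃ n, E.stopWords t V n u with hT
  set S : Set (List (Fin E.g)) := {v | u ++ v ∈ T} with hS
  have hcov : A ⊆ ⋃ v ∈ S, E.cylinder v := by
    intro y hy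
    obtain ⟨x, hx, rfl⟩ := E.exists_iterate_eq u (hA1 hy)
    obtain ⟨w, hxw, hwV⟩ := hV x (hAV (hAinv u x hx hy))
    obtain ⟨v, hv, hxv⟩ := E.exists_mem_cylinder_of_length (E.cylinder_subset u hx)
      (max u.length w.length)
    obtain ⟨w', rfl⟩ := E.exists_eq_append_of_mem hxw hxv (hv ▸ le_max_right _ _)
    obtain ⟨v', hv'⟩ := E.exists_eq_append_of_mem hx hxv (hv ▸ le_max_left _ _)
    have hsub := (E.cylinder_append_subset w w').trans hwV
    rw [hv'] at hxv hsub
    obtain ⟨w₀, hw₀, hxw₀⟩ := exists_mem_stopWords (t := t) hxv hsub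
    obtain ⟨v₀, rfl⟩ := exists_eq_append_of_mem_stopWords hw₀
    exact mem_biUnion (show v₀ ∈ S from mem_iUnion.2 ⟨_, hw₀⟩) (E.mem_cylinder_append.1 hxw₀).2
  calc c * E.len u ^ t ≤ (∑' v : S, E.len v ^ t) * E.len u ^ t := by gcongr; exact hc S hcov
    _ = ∑' v : S, E.len v ^ t * E.len u ^ t := ENNReal.tsum_mul_right.symm
    _ ≤ ∑' v : S, ENNReal.ofReal K ^ t * E.len (u ++ v) ^ t := by
        refine ENNReal.tsum_le_tsum fun v => ?_
        rw [← ENNReal.mul_rpow_of_nonneg _ _ ht0.le, ← ENNReal.mul_rpow_of_nonneg _ _ ht0.le,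
          mul_comm (E.len v)]
        exact ENNReal.rpow_le_rpow (hK u v).2 ht0.le
    _ = ENNReal.ofReal K ^ t * ∑' v : S, E.len (u ++ v) ^ t := ENNReal.tsum_mul_left
    _ ≤ ENNReal.ofReal K ^ t * ∑' w : T, E.len w ^ t := by
        gcongr
        exact ENNReal.tsum_comp_le_tsum_of_injective
          (f := fun v : S => (⟨u ++ v, v.2⟩ : T))
          (fun v w h => Subtype.ext (List.append_cancel_left (Subtype.ext_iff.1 h)))
          fun w : T => E.len w ^ t
    _ ≤ ENNReal.ofReal K ^ t * E.limContent t V u := by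
        gcongr
        exact ENNReal.tsum_iUnion_le_of_monotone (monotone_stopWords u)
          (f := fun v => E.len v ^ t) fun n => tsum_stopWords_le n u

end ExpandingFullShift

namespace ExpandingFullShift

theorem isSpreadable_interior {E : ExpandingFullShift} {t : ℝ} (ht0 : 0 < t) (ht1 : t < 1) {K : ℝ}
    (hK1 : 1 ≤ K) (hK : E.HasBoundedDistortion K) {A V : Set ℝ} (hA1 : A ⊆ Ico 0 1) (hAV : A ⊆ V)
    (hV : ∀ x ∈ V, ∃ w, x ∈ E.cylinder w ∧ E.cylinder w ⊆ V)
    (hAinv : ∀ u, ∀ x ∈ E.cylinder u, E.f^[u.length] x ∈ A → x ∈ A)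
    (hdim : ENNReal.ofReal t < dimH A) : IsSpreadable t (interior V) := by
  obtain ⟨ρ, hρ⟩ := hK.exists_isRatio hK1
  obtain ⟨c, hc0, hc⟩ := exists_le_tsum_of_lt_dimH (E := E) ht0 hdim
  have hKpos : 0 < K := by linarith
  have hktop : ENNReal.ofReal K ^ t ≠ ⊤ := ENNReal.rpow_ne_top_of_nonneg ht0.le (by simp)
  obtain ⟨κ, hκpos, hκ⟩ := exists_between (ENNReal.div_pos hc0 hktop)
  have hκtop : κ ≠ ⊤ := hκ.ne_top
  have hl0 : ∀ u, E.len u ^ t ≠ 0 := fun u => by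
    simp [ENNReal.rpow_eq_zero_iff, E.len_pos u, E.len_ne_top u]
  have hltop : ∀ u, E.len u ^ t ≠ ⊤ :=
    fun u => ENNReal.rpow_ne_top_of_nonneg ht0.le (E.len_ne_top u)
  have hex : ∀ u, ∃ ν : Measure ℝ, ν univ = κ * E.len u ^ t ∧
      ν (E.cylinder u ∩ interior V)ᶜ = 0 ∧ (∃ D : ℝ≥0∞, D ≠ ⊤ ∧ ∀ s, ν s ≤ D * volume s) ∧
      ∀ v, ν (E.cylinder v) ≤ E.len v ^ t := by
    intro u
    have hlt : κ * E.len u ^ t < E.limContent t V u := by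
      calc κ * E.len u ^ t < c / ENNReal.ofReal K ^ t * E.len u ^ t :=
            ENNReal.mul_lt_mul_left (hl0 u) (hltop u) hκ
        _ = c * E.len u ^ t / ENNReal.ofReal K ^ t := by
            rw [ENNReal.div_eq_inv_mul, ENNReal.div_eq_inv_mul, mul_assoc]
        _ ≤ E.limContent t V u := ENNReal.div_le_of_le_mul'
            (mul_rpow_le_limContent ht0 hK hA1 hAV hV hAinv hc u)
    obtain ⟨d, hd⟩ := lt_iSup_iff.1 hlt
    exact exists_measure_of_le_treeContent ht0 ht1 d u hd.le
  choose ν hν1 hν0 hνD hνt using hex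
  choose D hD hνD using hνD
  choose a b hab hcyl using E.exists_cylinder_eq_Ico
  have hm0 : ∀ u, κ * E.len u ^ t ≠ 0 := fun u => mul_ne_zero hκpos.ne' (hl0 u)
  have hmtop : ∀ u, κ * E.len u ^ t ≠ ⊤ := fun u => ENNReal.mul_ne_top hκtop (hltop u)
  refine ⟨κ⁻¹ * (ENNReal.ofReal ρ ^ (t - 1) * 3), ENNReal.mul_ne_top
    (ENNReal.inv_ne_top.2 hκpos.ne') (ENNReal.mul_ne_top
      (by simp [ENNReal.rpow_eq_top_iff, hρ.pos]) (by simp)), fun δ hδ => ?_⟩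
  obtain ⟨n, hn⟩ := hρ.exists_len_le (δ := ENNReal.ofReal δ) (by simpa using hδ)
  refine ⟨Fin n → Fin E.g, inferInstance, fun w => a (List.ofFn w), fun w => b (List.ofFn w),
    fun w => (κ * E.len (List.ofFn w) ^ t)⁻¹ • ν (List.ofFn w), fun w => ⟨hab _, ?_⟩, ?_, ?_,
    fun w => ?_⟩
  · have := hn (List.ofFn w) (by simp)
    rwa [len, hcyl, Real.volume_Ico, ENNReal.ofReal_le_ofReal_iff hδ.le] at this
  · intro v w hvw
    simp only [Function.onFun, ← hcyl]
    exact Set.disjoint_left.2 fun x hv hw =>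
      hvw (List.ofFn_injective (E.eq_of_mem_cylinder hv hw (by simp)))
  · intro x hx
    obtain ⟨u, rfl, hxu⟩ := E.exists_mem_cylinder_of_length hx n
    refine mem_iUnion.2 ⟨fun i => u[i], ?_⟩
    rw [← hcyl]
    simpa using hxu
  · set u := List.ofFn w
    simp only [← hcyl, Measure.smul_apply, smul_eq_mul]
    refine ⟨?_, ?_, ⟨(κ * E.len u ^ t)⁻¹ * D u,
      ENNReal.mul_ne_top (ENNReal.inv_ne_top.2 (hm0 u)) (hD u), fun s => ?_⟩, fun x y => ?_⟩
    · rw [hν1, ENNReal.inv_mul_cancel (hm0 u) (hmtop u)]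
    · rw [hν0, mul_zero]
    · rw [mul_assoc]
      exact mul_le_mul_right (hνD u s) _
    · have hsupp : ν u (Ico 0 1)ᶜ = 0 := measure_mono_null (compl_subset_compl.2
        (inter_subset_left.trans (E.cylinder_subset u))) (hν0 u)
      have hfr := hρ.frostman ht0 ht1 hsupp (c := 1) (by simpa using hνt u) x y
      rw [one_mul] at hfr
      calc (κ * E.len u ^ t)⁻¹ * ν u (Ico x y) * E.len u ^ t
          = κ⁻¹ * ν u (Ico x y) * ((E.len u ^ t)⁻¹ * E.len u ^ t) := by
            rw [ENNReal.mul_inv (Or.inl hκpos.ne') (Or.inl hκtop)]; ring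
        _ = κ⁻¹ * ν u (Ico x y) := by rw [ENNReal.inv_mul_cancel (hl0 u) (hltop u), mul_one]
        _ ≤ κ⁻¹ * (ENNReal.ofReal ρ ^ (t - 1) * 3) * volume (Ico x y) ^ t := by
            rw [mul_assoc]; exact mul_le_mul_right hfr _

variable (E : ExpandingFullShift) {m : ℕ} {p : (Fin m → Fin E.g) → ℝ}

theorem freq_eq_of_mem_cylinder {u : List (Fin E.g)} {x y : ℝ} (hx : x ∈ E.cylinder u)
    (hy : y ∈ E.cylinder u) (w : Fin m → Fin E.g) :
    E.freq w x u.length = E.freq w y u.length := by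
  have key : ∀ j, j < u.length → ∀ i, E.f^[j] x ∈ E.branch i ↔ E.f^[j] y ∈ E.branch i :=
    fun j hj i => ⟨fun h => E.eq_of_mem_branch (hx.2 j hj) h ▸ hy.2 j hj,
      fun h => E.eq_of_mem_branch (hy.2 j hj) h ▸ hx.2 j hj⟩
  rw [freq, freq]
  congr 3
  refine Finset.filter_congr fun i hi => forall_congr' fun k => key _ ?_ _
  have := Finset.mem_range.1 hi
  omega

theorem exists_cylinder_subset_gsetApprox {n : ℕ} {ε x : ℝ} (hx : x ∈ E.GsetApprox m p n ε) :
    ∃ u, x ∈ E.cylinder u ∧ E.cylinder u ⊆ E.GsetApprox m p n ε := by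
  obtain ⟨u, rfl, hu⟩ := E.exists_mem_cylinder_of_length hx.1 n
  exact ⟨u, hu, fun y hy => ⟨E.cylinder_subset u hy, fun w =>
    E.freq_eq_of_mem_cylinder hu hy w ▸ hx.2 w⟩⟩

theorem isFreqAccum_iff {x : ℝ} : E.IsFreqAccum m p x ↔
    ∀ ε > 0, ∃ᶠ n in atTop, ∀ w, |E.freq w x n - p w| < ε := by
  rw [IsFreqAccum, Metric.nhds_basis_ball.mapClusterPt_iff_frequently]
  refine forall₂_congr fun ε hε => ?_
  simp only [Metric.mem_ball, dist_pi_lt_iff hε, Real.dist_eq]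

theorem abs_freq_succ_sub_freq_le (w : Fin m → Fin E.g) (x : ℝ) {n : ℕ} (hn : m < n) :
    |E.freq w x (n + 1) - E.freq w (E.f x) n| ≤ 1 / ((n - m : ℕ) : ℝ) := by
  obtain ⟨M, rfl⟩ := Nat.exists_eq_add_of_lt hn
  rw [freq, freq, show m + M + 1 + 1 - m = M + 1 + 1 by omega, show m + M + 1 - m = M + 1 by omega]
  set N := ((Finset.range (M + 1)).filter
    (fun i => ∀ k : Fin m, E.f^[i + k] (E.f x) ∈ E.branch (w k))).card with hN
  have hNle : N ≤ M + 1 := by simpa using Finset.card_filter_le (Finset.range (M + 1)) _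
  obtain ⟨b, hb, hcard⟩ : ∃ b ≤ 1, ((Finset.range (M + 1 + 1)).filter
      (fun i => ∀ k : Fin m, E.f^[i + k] x ∈ E.branch (w k))).card = N + b := by
    refine ⟨if ∀ k : Fin m, E.f^[0 + k] x ∈ E.branch (w k) then 1 else 0, ?_, ?_⟩
    · split_ifs <;> simp
    · rw [Finset.card_filter, Finset.sum_range_succ', hN, Finset.card_filter]
      congr 1
      refine Finset.sum_congr rfl fun i _ => ?_
      simp only [show ∀ k : Fin m, i + 1 + (k : ℕ) = i + k + 1 by intro k; omega,
        Function.iterate_succ_apply]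
  rw [hcard]
  have hN' : (N : ℝ) ≤ M + 1 := by exact_mod_cast hNle
  have hb' : (b : ℝ) ≤ 1 := by exact_mod_cast hb
  have hb0 : (0 : ℝ) ≤ b := b.cast_nonneg
  have hN0 : (0 : ℝ) ≤ N := N.cast_nonneg
  have hM : (0 : ℝ) ≤ M := M.cast_nonneg
  push_cast
  rw [div_sub_div _ _ (by positivity) (by positivity), abs_div,
    abs_of_pos (show (0 : ℝ) < (M + 1 + 1) * (M + 1) by positivity),
    div_le_div_iff₀ (by positivity) (by positivity), one_mul]
  refine mul_le_mul_of_nonneg_right ?_ (by positivity)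
  rw [abs_le]
  constructor <;> nlinarith

variable (m p) in
/-- The set of points with `p̄` as an accumulation point of the word frequencies. -/
def accumSet : Set ℝ := {x ∈ Ico (0:ℝ) 1 | E.IsFreqAccum m p x}

theorem mem_accumSet_of_apply_mem {x : ℝ} (hx : x ∈ Ico (0:ℝ) 1) (h : E.f x ∈ E.accumSet m p) :
    x ∈ E.accumSet m p := by
  refine ⟨hx, E.isFreqAccum_iff.2 fun ε hε => ?_⟩
  have h1 := E.isFreqAccum_iff.1 h.2 (ε / 2) (by positivity)
  have h2 : ∀ᶠ n : ℕ in atTop, 1 / ((n - m : ℕ) : ℝ) < ε / 2 :=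
    (tendsto_one_div_atTop_nhds_zero_nat.comp (tendsto_sub_atTop_nat m)).eventually
      (gt_mem_nhds (by positivity))
  refine (tendsto_add_atTop_nat 1).frequently
    ((h1.and_eventually (h2.and (eventually_gt_atTop m))).mono ?_)
  rintro n ⟨hn1, hn2, hn3⟩ w
  have h3 := E.abs_freq_succ_sub_freq_le w x hn3
  calc |E.freq w x (n + 1) - p w|
      ≤ |E.freq w x (n + 1) - E.freq w (E.f x) n| + |E.freq w (E.f x) n - p w| :=
        abs_sub_le _ _ _
    _ < ε := by linarith [hn1 w]

theorem mem_accumSet_of_iterate_mem {u : List (Fin E.g)} {x : ℝ} (hx : x ∈ E.cylinder u)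
    (h : E.f^[u.length] x ∈ E.accumSet m p) : x ∈ E.accumSet m p := by
  induction u generalizing x with
  | nil => exact h
  | cons i u ih =>
    exact E.mem_accumSet_of_apply_mem (E.cylinder_subset _ hx)
      (ih (E.mem_cylinder_cons.1 hx).2 h)

variable (m p) in
/-- Points whose word frequencies are `1 / (k + 1)`-close to `p̄` at some time `n ≥ k`. -/
def approxSet (k : ℕ) : Set ℝ := ⋃ n ≥ k, E.GsetApprox m p n (1 / (k + 1))

theorem accumSet_subset_approxSet (k : ℕ) : E.accumSet m p ⊆ E.approxSet m p k := by
  intro x hx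
  obtain ⟨n, hkn, hn⟩ :=
    frequently_atTop.1 (E.isFreqAccum_iff.1 hx.2 (1 / (k + 1)) (by positivity)) k
  exact mem_biUnion hkn ⟨hx.1, hn⟩

theorem iInter_approxSet_subset : ⋂ k, E.approxSet m p k ⊆ E.accumSet m p := by
  intro x hx
  have hx' : ∀ k : ℕ, ∃ n ≥ k, x ∈ E.GsetApprox m p n (1 / (k + 1)) := by
    simpa [approxSet] using hx
  obtain ⟨n, -, hn⟩ := hx' 0
  refine ⟨hn.1, E.isFreqAccum_iff.2 fun ε hε => frequently_atTop.2 fun N => ?_⟩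
  obtain ⟨k, hk⟩ := exists_nat_one_div_lt hε
  obtain ⟨n, hn, hxn⟩ := hx' (max k N)
  refine ⟨n, (le_max_right _ _).trans hn, fun w => (hxn.2 w).trans (lt_of_le_of_lt ?_ hk)⟩
  exact one_div_le_one_div_of_le (by positivity) (by push_cast; gcongr; exact le_max_left _ _)

theorem isSpreadable_interior_approxSet {t : ℝ} (ht0 : 0 < t) (ht1 : t < 1) {K : ℝ} (hK1 : 1 ≤ K)
    (hK : E.HasBoundedDistortion K) (hdim : ENNReal.ofReal t < dimH (E.accumSet m p)) (k : ℕ) :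
    IsSpreadable t (interior (E.approxSet m p k)) := by
  refine isSpreadable_interior ht0 ht1 hK1 hK (fun x hx => hx.1)
    (E.accumSet_subset_approxSet k) (fun x hx => ?_)
    (fun u x hx h => E.mem_accumSet_of_iterate_mem hx h) hdim
  obtain ⟨n, hkn, hxn⟩ := mem_iUnion₂.1 hx
  obtain ⟨u, hxu, hu⟩ := E.exists_cylinder_subset_gsetApprox hxn
  exact ⟨u, hxu, hu.trans (subset_biUnion_of_mem (u := fun n => E.GsetApprox m p n _) hkn)⟩

end ExpandingFullShift

open ExpandingFullShift in
/-- the Hausdorff dimension of a countable intersection of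
accumulation-frequency sets, for different expanding maps with bounded distortion,
equals the infimum of their dimensions. -/
theorem dimH_iInter_freqAccum (E : ℕ → ExpandingFullShift)
    (hbd : ∀ i, ∃ K : ℝ, 1 ≤ K ∧ (E i).HasBoundedDistortion K)
    (m : ℕ → ℕ) (hm : ∀ i, 0 < m i)
    (p : ∀ i, (Fin (m i) → Fin (E i).g) → ℝ) (hp : ∀ i, IsProbVector (p i)) :
    dimH (⋂ i, {x ∈ Ico (0:ℝ) 1 | (E i).IsFreqAccum (m i) (p i) x}) =
      ⨅ i, dimH {x ∈ Ico (0:ℝ) 1 | (E i).IsFreqAccum (m i) (p i) x} := by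
  refine le_antisymm (le_iInf fun i => dimH_mono (iInter_subset _ i)) ?_
  refine ENNReal.le_of_forall_nnreal_lt fun r hr => ?_
  rcases eq_or_ne r 0 with rfl | hr0
  · simp
  have hdim : ∀ i, (r : ℝ≥0∞) < dimH ((E i).accumSet (m i) (p i)) :=
    fun i => hr.trans_le (iInf_le _ i)
  have hr0' : (0 : ℝ) < r := by exact_mod_cast pos_iff_ne_zero.2 hr0
  have hr1 : (r : ℝ) < 1 := by
    have := (hdim 0).trans_le ((dimH_mono (subset_univ _)).trans Real.dimH_univ.le)
    exact_mod_cast this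
  rw [← ENNReal.ofReal_coe_nnreal] at hdim ⊢
  obtain ⟨W, hW⟩ : ∃ W : ℕ → ℕ → Set ℝ, ∀ i k, W i k = interior ((E i).approxSet (m i) (p i) k) :=
    ⟨_, fun _ _ => rfl⟩
  refine (le_dimH_iInter_of_isSpreadable hr0' hr1
    (V := fun j => W j.unpair.1 j.unpair.2)
    (fun j => ?_) fun j => ?_).trans (dimH_mono (subset_iInter fun i => ?_))
  · exact hW _ _ ▸ isOpen_interior
  · obtain ⟨K, hK1, hK⟩ := hbd j.unpair.1
    exact hW _ _ ▸ (E j.unpair.1).isSpreadable_interior_approxSet hr0' hr1 hK1 hK (hdim _) _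
  · refine Subset.trans (subset_iInter fun k => ?_) (E i).iInter_approxSet_subset
    refine (iInter_subset _ (Nat.pair i k)).trans ?_
    simpa [hW] using interior_subset
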